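/- Fix an integer D ≥ 2 and let (V, σ_0, …, σ_D) be a connected edge (D+1)-colored graph with V nonempty. Then the total number of faces F satisfies 4·F ≤ 4·D + D·(D−1)·|V|; in other words, the reduced degree ω̂ := D + D(D−1)/4 · |V| − F is non-negative. -/

import Mathlib

namespace ColoredGraph

open Equiv

variable {V : Type*}

/-- The `ZMod 2`-valued functions on `V` that are invariant under every permutation in `S`. -/
def invariants (S : Set (Perm V)) : Submodule (ZMod 2) (V → ZMod 2) where
  carrier := {f | ∀ g ∈ S, ∀ v, f (g v) = f v}
  add_mem' := fun hf hg s hs v => by simp [hf s hs v, hg s hs v]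
  zero_mem' := fun _ _ _ => rfl
  smul_mem' := fun c f hf s hs v => by simp [hf s hs v]

lemma invariants_anti {S T : Set (Perm V)} (h : S ⊆ T) : invariants T ≤ invariants S :=
  fun _ hf g hg => hf g (h hg)

lemma apply_smul_of_mem_invariants {S : Set (Perm V)} {f : V → ZMod 2} (hf : f ∈ invariants S)
    (g : Subgroup.closure S) (v : V) : f (g • v) = f v := by
  obtain ⟨g, hg⟩ := g
  change f (g v) = f v
  induction hg using Subgroup.closure_induction generalizing v with
  | mem x hx => exact hf x hx v
  | one => rfl
  | mul x y _ _ hx hy => rw [Perm.mul_apply, hx, hy]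
  | inv x _ hx => simpa using (hx (x⁻¹ v)).symm

/-- Invariant functions are the functions on the set of orbits. -/
def invariantsEquiv (S : Set (Perm V)) :
    invariants S ≃ₗ[ZMod 2]
      (MulAction.orbitRel.Quotient (Subgroup.closure S : Subgroup (Perm V)) V → ZMod 2) where
  toFun f := Quotient.lift f.1 (by
    rintro a b ⟨g, rfl⟩
    exact apply_smul_of_mem_invariants f.2 g b)
  invFun f := ⟨fun v => f (Quotient.mk _ v), fun g hg v => congrArg f
    (Quotient.sound ⟨⟨g, Subgroup.subset_closure hg⟩, rfl⟩)⟩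
  map_add' f g := by ext q; induction q using Quotient.inductionOn; rfl
  map_smul' c f := by ext q; induction q using Quotient.inductionOn; rfl
  left_inv f := rfl
  right_inv f := by ext q; induction q using Quotient.inductionOn; rfl

lemma finrank_invariants [Finite V] (S : Set (Perm V)) :
    Module.finrank (ZMod 2) (invariants S) =
      Nat.card (MulAction.orbitRel.Quotient (Subgroup.closure S : Subgroup (Perm V)) V) := by
  classical
  have := Fintype.ofFinite
    (MulAction.orbitRel.Quotient (Subgroup.closure S : Subgroup (Perm V)) V)
  rw [(invariantsEquiv S).finrank_eq, Module.finrank_fintype_fun_eq_card, Nat.card_eq_fintype_card]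

lemma two_mul_finrank_invariants_singleton_le [Fintype V] {s : Perm V} (hfpf : ∀ v, s v ≠ v) :
    2 * Module.finrank (ZMod 2) (invariants {s}) ≤ Fintype.card V := by
  classical
  rw [finrank_invariants]
  have := Fintype.ofFinite
    (MulAction.orbitRel.Quotient (Subgroup.closure {s} : Subgroup (Perm V)) V)
  rw [Nat.card_eq_fintype_card]
  let q : V → MulAction.orbitRel.Quotient (Subgroup.closure {s} : Subgroup (Perm V)) V :=
    Quotient.mk _
  refine Finset.mul_card_image_le_card_of_maps_to (s := Finset.univ) (t := Finset.univ) (f := q)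
    (fun _ _ => Finset.mem_univ _) 2 fun b _ => ?_
  obtain ⟨v, rfl⟩ := Quotient.exists_rep b
  rw [← Finset.card_pair (hfpf v)]
  refine Finset.card_le_card fun w hw => ?_
  simp only [Finset.mem_insert, Finset.mem_singleton] at hw
  simp only [Finset.mem_filter, Finset.mem_univ, true_and]
  rcases hw with rfl | rfl
  · exact Quotient.sound ⟨⟨s, Subgroup.subset_closure rfl⟩, rfl⟩
  · rfl

lemma add_self_eq_zero_fun (f : V → ZMod 2) : f + f = 0 :=
  funext fun _ => CharTwo.add_self_eq_zero _

variable {n : ℕ}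

/-- The boundary map from edges to vertices, with edge chains seen as invariant functions. -/
def edgeBoundary (τ : Fin n → Perm V) :
    (∀ k, invariants {τ k}) →ₗ[ZMod 2] (V → ZMod 2) :=
  ∑ k, (invariants {τ k}).subtype ∘ₗ LinearMap.proj k

lemma edgeBoundary_apply (τ : Fin n → Perm V) (f : ∀ k, invariants {τ k}) :
    edgeBoundary τ f = ∑ k, (f k : V → ZMod 2) := by
  simp [edgeBoundary]

lemma single_add_single_mem_range [DecidableEq V] {τ : Fin n → Perm V}
    (hinv : ∀ i, τ i * τ i = 1) (k : Fin n) (v : V) :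
    (Pi.single v 1 + Pi.single (τ k v) 1 : V → ZMod 2) ∈ LinearMap.range (edgeBoundary τ) := by
  have hinv' : ∀ w, τ k (τ k w) = w := fun w => by rw [← Perm.mul_apply, hinv]; rfl
  refine ⟨Pi.single k ⟨Pi.single v 1 + Pi.single (τ k v) 1, ?_⟩, ?_⟩
  · rintro _ rfl w
    have h1 : τ k w = v ↔ w = τ k v := ⟨fun h => by rw [← h, hinv'], fun h => by rw [h, hinv']⟩
    simp only [Pi.add_apply, Pi.single_apply, h1, (τ k).injective.eq_iff]
    exact add_comm _ _
  · rw [edgeBoundary_apply, Finset.sum_eq_single k]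
    · simp
    · intro j _ hj
      simp [hj]
    · simp

lemma single_add_single_smul_mem [DecidableEq V] {S : Set (Perm V)}
    {R : Submodule (ZMod 2) (V → ZMod 2)}
    (hR : ∀ s ∈ S, ∀ v, (Pi.single v 1 + Pi.single (s v) 1 : V → ZMod 2) ∈ R)
    (g : Subgroup.closure S) (v : V) :
    (Pi.single v 1 + Pi.single (g • v) 1 : V → ZMod 2) ∈ R := by
  obtain ⟨g, hg⟩ := g
  change (Pi.single v 1 + Pi.single (g v) 1 : V → ZMod 2) ∈ R
  induction hg using Subgroup.closure_induction generalizing v with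
  | mem x hx => exact hR x hx v
  | one => simp [add_self_eq_zero_fun]
  | mul x y _ _ hx hy =>
    have := R.add_mem (hy v) (hx (y v))
    rwa [add_assoc, ← add_assoc (Pi.single (y v) 1), add_self_eq_zero_fun, zero_add] at this
  | inv x _ hx => simpa [add_comm] using hx (x⁻¹ v)

lemma card_le_finrank_add_one [Fintype V] [DecidableEq V] [Nonempty V]
    {R : Submodule (ZMod 2) (V → ZMod 2)}
    (hR : ∀ v w, (Pi.single v 1 + Pi.single w 1 : V → ZMod 2) ∈ R) :
    Fintype.card V ≤ Module.finrank (ZMod 2) R + 1 := by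
  obtain ⟨v₀⟩ := ‹Nonempty V›
  have htop : R ⊔ Submodule.span (ZMod 2) {Pi.single v₀ 1} = ⊤ := by
    rw [eq_top_iff, ← (Pi.basisFun (ZMod 2) V).span_eq, Submodule.span_le]
    rintro _ ⟨v, rfl⟩
    rw [Pi.basisFun_apply]
    refine Submodule.mem_sup.2 ⟨_, hR v v₀, _, Submodule.mem_span_singleton_self _, ?_⟩
    rw [add_assoc, add_self_eq_zero_fun, add_zero]
  have h1 := Submodule.finrank_add_le_finrank_add_finrank R
    (Submodule.span (ZMod 2) {Pi.single v₀ 1})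
  have h2 := finrank_span_le_card (R := ZMod 2) {(Pi.single v₀ 1 : V → ZMod 2)}
  rw [Set.toFinset_singleton, Finset.card_singleton] at h2
  rw [htop, finrank_top, Module.finrank_fintype_fun_eq_card] at h1
  omega

variable [NeZero n]

/-- The boundary map from the faces of a jacket to its edges: an edge of color `k` lies on one face
with colors `(k - 1, k)` and one face with colors `(k, k + 1)`. -/
def faceBoundary (τ : Fin n → Perm V) :
    (∀ k, invariants {τ k, τ (k + 1)}) →ₗ[ZMod 2] (∀ k, invariants {τ k}) :=
  LinearMap.pi fun k =>
    Submodule.inclusion (invariants_anti (by simp)) ∘ₗ LinearMap.proj k +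
    Submodule.inclusion (invariants_anti (by simp)) ∘ₗ LinearMap.proj (k - 1)

lemma coe_faceBoundary_apply (τ : Fin n → Perm V) (h : ∀ k, invariants {τ k, τ (k + 1)})
    (k : Fin n) : (faceBoundary τ h k : V → ZMod 2) = h k + h (k - 1) := rfl

lemma edgeBoundary_faceBoundary (τ : Fin n → Perm V) (h : ∀ k, invariants {τ k, τ (k + 1)}) :
    edgeBoundary τ (faceBoundary τ h) = 0 := by
  rw [edgeBoundary_apply]
  simp only [coe_faceBoundary_apply, Finset.sum_add_distrib]
  rw [show ∑ k, (h (k - 1) : V → ZMod 2) = ∑ k, (h k : V → ZMod 2) from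
    Equiv.sum_comp (Equiv.subRight (1 : Fin n)) fun k => (h k : V → ZMod 2)]
  exact add_self_eq_zero_fun _

lemma eq_apply_zero_of_eq_apply_sub_one {α : Type*} {P : Fin n → α} (hP : ∀ k, P k = P (k - 1))
    (k : Fin n) : P k = P 0 := by
  have : ∀ m : ℕ, P (Fin.ofNat n m) = P 0 := fun m => by
    induction m with
    | zero => rfl
    | succ m ih =>
      have hm : Fin.ofNat n (m + 1) = Fin.ofNat n m + 1 := by
        ext
        simp [Fin.val_add]
      rw [hP, hm, add_sub_cancel_right, ih]
  simpa using this k.val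

lemma finrank_ker_faceBoundary_le_one [Finite V] [Nonempty V] {τ : Fin n → Perm V}
    (hconn : MulAction.IsPretransitive
      (Subgroup.closure (Set.range τ) : Subgroup (Perm V)) V) :
    Module.finrank (ZMod 2) (LinearMap.ker (faceBoundary τ)) ≤ 1 := by
  obtain ⟨v₀⟩ := ‹Nonempty V›
  let ev : LinearMap.ker (faceBoundary τ) →ₗ[ZMod 2] ZMod 2 :=
    LinearMap.proj v₀ ∘ₗ (invariants _).subtype ∘ₗ LinearMap.proj 0 ∘ₗ Submodule.subtype _
  suffices hev : Function.Injective ev by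
    simpa using LinearMap.finrank_le_finrank_of_injective hev
  rw [← LinearMap.ker_eq_bot, LinearMap.ker_eq_bot']
  rintro ⟨h, hh⟩ h0
  replace h0 : (h 0 : V → ZMod 2) v₀ = 0 := h0
  have hstep : ∀ k, (h k : V → ZMod 2) = h (k - 1) := fun k => by
    have hk : (h k : V → ZMod 2) + h (k - 1) = 0 := by
      rw [← coe_faceBoundary_apply, LinearMap.mem_ker.1 hh]; rfl
    rw [← sub_eq_zero, ← hk]
    exact funext fun _ => CharTwo.sub_eq_add _ _
  have hall : ∀ k, (h k : V → ZMod 2) = h 0 :=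
    eq_apply_zero_of_eq_apply_sub_one (P := fun k => (h k : V → ZMod 2)) hstep
  have hmem : (h 0 : V → ZMod 2) ∈ invariants (Set.range τ) := by
    rintro _ ⟨k, rfl⟩ v
    rw [← hall k]
    exact (h k).2 _ (by simp) v
  refine Subtype.ext <| funext fun k => Subtype.ext <| funext fun v => ?_
  obtain ⟨g, rfl⟩ := MulAction.exists_smul_eq
    (Subgroup.closure (Set.range τ) : Subgroup (Perm V)) v₀ v
  change (h k : V → ZMod 2) _ = 0
  rw [hall, apply_smul_of_mem_invariants hmem, h0]

/-- The Euler characteristic of a jacket is at most two. -/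
theorem jacket_faces_le [Fintype V] [Nonempty V] {τ : Fin n → Perm V}
    (hinv : ∀ i, τ i * τ i = 1) (hfpf : ∀ i v, τ i v ≠ v)
    (hconn : MulAction.IsPretransitive
      (Subgroup.closure (Set.range τ) : Subgroup (Perm V)) V) :
    2 * (∑ k, Nat.card (MulAction.orbitRel.Quotient
        (Subgroup.closure {τ k, τ (k + 1)} : Subgroup (Perm V)) V)) + 2 * Fintype.card V
      ≤ 4 + n * Fintype.card V := by
  classical
  have hF := LinearMap.finrank_range_add_finrank_ker (faceBoundary τ)
  have hE := LinearMap.finrank_range_add_finrank_ker (edgeBoundary τ)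
  rw [Module.finrank_pi_fintype] at hF hE
  have hker := finrank_ker_faceBoundary_le_one hconn
  have hle : Module.finrank (ZMod 2) (LinearMap.range (faceBoundary τ)) ≤
      Module.finrank (ZMod 2) (LinearMap.ker (edgeBoundary τ)) := by
    refine Submodule.finrank_mono ?_
    rintro _ ⟨h, rfl⟩
    exact edgeBoundary_faceBoundary τ h
  have hV := card_le_finrank_add_one (R := LinearMap.range (edgeBoundary τ)) fun v w => by
    obtain ⟨g, rfl⟩ := MulAction.exists_smul_eq
      (Subgroup.closure (Set.range τ) : Subgroup (Perm V)) v w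
    refine single_add_single_smul_mem ?_ g v
    rintro _ ⟨k, rfl⟩ v
    exact single_add_single_mem_range hinv k v
  have hedges : 2 * ∑ k, Module.finrank (ZMod 2) (invariants {τ k}) ≤ n * Fintype.card V := by
    rw [Finset.mul_sum]
    simpa using Finset.sum_le_card_nsmul Finset.univ _ _ fun k _ =>
      two_mul_finrank_invariants_singleton_le (hfpf k)
  simp only [← finrank_invariants]
  omega

lemma sum_perm_pair_eq {ι : Type*} [Fintype ι] [DecidableEq ι] (f : ι → ι → ℕ) {a b c d : ι}
    (hab : a ≠ b) (hcd : c ≠ d) : ∑ π : Perm ι, f (π a) (π b) = ∑ π : Perm ι, f (π c) (π d) := by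
  obtain ⟨t, ht1, ht2⟩ := MulAction.is_two_pretransitive_iff.1
    (Perm.isMultiplyPretransitive ι 2) hab hcd
  rw [← Equiv.sum_comp (Equiv.mulRight t) fun π => f (π a) (π b)]
  simp only [Perm.smul_def] at ht1 ht2
  simp [ht1, ht2]

/-- Averaging over all cyclic orders of the colors. -/
lemma sum_offDiag_mul_factorial {D : ℕ} (hD : 1 ≤ D) (f : Fin (D + 1) → Fin (D + 1) → ℕ) :
    (∑ p ∈ Finset.univ.offDiag, f p.1 p.2) * (D + 1).factorial =
      D * ∑ π : Perm (Fin (D + 1)), ∑ k, f (π k) (π (k + 1)) := by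
  have hne : ∀ k : Fin (D + 1), k ≠ k + 1 := fun k h => by
    have : Nontrivial (Fin (D + 1)) := Fin.nontrivial_iff_two_le.2 (by omega)
    simp at h
    omega
  have hcyc : ∑ π : Perm (Fin (D + 1)), ∑ k, f (π k) (π (k + 1)) =
      (D + 1) * ∑ π : Perm (Fin (D + 1)), f (π 0) (π (0 + 1)) := by
    rw [Finset.sum_comm, Finset.sum_congr rfl fun k _ => sum_perm_pair_eq f (hne k) (hne 0)]
    simp
  have hoff : ∑ π : Perm (Fin (D + 1)), ∑ p ∈ Finset.univ.offDiag, f (π p.1) (π p.2) =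
      (D + 1) * D * ∑ π : Perm (Fin (D + 1)), f (π 0) (π (0 + 1)) := by
    rw [Finset.sum_comm, Finset.sum_congr rfl fun p hp =>
      sum_perm_pair_eq f (Finset.mem_offDiag.1 hp).2.2 (hne 0)]
    simp [Finset.offDiag_card, Nat.mul_succ, Nat.succ_mul]
  have hconst : ∀ π : Perm (Fin (D + 1)), ∑ p ∈ Finset.univ.offDiag, f (π p.1) (π p.2) =
      ∑ p ∈ Finset.univ.offDiag, f p.1 p.2 := fun π =>
    Finset.sum_equiv (Equiv.prodCongr π π) (by simp) (by simp)
  rw [hcyc, ← mul_assoc, mul_comm D, ← hoff, Finset.sum_congr rfl fun π _ => hconst π]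
  simp [Fintype.card_perm, mul_comm]

lemma sum_offDiag_eq_two_mul {ι : Type*} [Fintype ι] [LinearOrder ι] {f : ι → ι → ℕ}
    (hf : ∀ i j, f i j = f j i) :
    ∑ p ∈ Finset.univ.offDiag, f p.1 p.2 =
      2 * ∑ p ∈ Finset.univ.filter (fun p : ι × ι => p.1 < p.2), f p.1 p.2 := by
  have hsplit : (Finset.univ.offDiag : Finset (ι × ι)) =
      Finset.univ.filter (fun p : ι × ι => p.1 < p.2) ∪
      Finset.univ.filter (fun p : ι × ι => p.2 < p.1) := by
    ext p
    simp [lt_or_lt_iff_ne]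
  rw [hsplit, Finset.sum_union, two_mul]
  · congr 1
    exact Finset.sum_equiv (Equiv.prodComm ι ι) (by simp) (fun p _ => hf _ _)
  · rw [Finset.disjoint_filter]
    exact fun p _ h => h.not_gt

end ColoredGraph


/-- **Non-negativity of the reduced degree of a connected edge `(D+1)`-colored graph.**
An edge `(D+1)`-colored graph is a finite nonempty vertex type `V` together with
fixed-point-free involutions `σ 0, …, σ D`; the faces with colors `(i,j)`, `i < j`, are
the orbits of the subgroup generated by `σ i` and `σ j`, and `F` is their total number.
If the graph is connected then `4·F ≤ 4·D + D·(D-1)·|V|`, i.e. the reduced degree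
`ω̂ = D + D(D-1)/4·|V| - F` is non-negative. -/
theorem reduced_degree_nonneg
    (D : ℕ) (hD : 2 ≤ D)
    (V : Type) [Fintype V] [Nonempty V]
    (σ : Fin (D + 1) → Equiv.Perm V)
    (hinv : ∀ i, σ i * σ i = 1) (hfpf : ∀ i v, σ i v ≠ v)
    (hconn : MulAction.IsPretransitive
      (Subgroup.closure (Set.range σ) : Subgroup (Equiv.Perm V)) V) :
    4 * (∑ ij ∈ Finset.univ.filter (fun ij : Fin (D + 1) × Fin (D + 1) => ij.1 < ij.2),
        Nat.card (MulAction.orbitRel.Quotient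
          (Subgroup.closure {σ ij.1, σ ij.2} : Subgroup (Equiv.Perm V)) V))
      ≤ 4 * D + D * (D - 1) * Nat.card V := by
  classical
  set f : Fin (D + 1) → Fin (D + 1) → ℕ := fun i j =>
    Nat.card (MulAction.orbitRel.Quotient
      (Subgroup.closure {σ i, σ j} : Subgroup (Equiv.Perm V)) V) with hf
  change 4 * (∑ p ∈ Finset.univ.filter (fun p : Fin (D + 1) × Fin (D + 1) => p.1 < p.2),
    f p.1 p.2) ≤ _
  have hsymm : ∀ i j, f i j = f j i := fun i j => by simp only [hf]; rw [Set.pair_comm]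
  have havg := ColoredGraph.sum_offDiag_mul_factorial (by omega) f
  rw [ColoredGraph.sum_offDiag_eq_two_mul hsymm] at havg
  have hjacket : ∀ π : Equiv.Perm (Fin (D + 1)),
      2 * ∑ k, f (π k) (π (k + 1)) ≤ 4 + (D - 1) * Nat.card V := fun π => by
    have h := ColoredGraph.jacket_faces_le (τ := σ ∘ π) (fun i => hinv (π i))
      (fun i => hfpf (π i)) (by rwa [π.surjective.range_comp])
    obtain ⟨d, rfl⟩ := Nat.exists_eq_add_of_le' hD
    rw [Nat.card_eq_fintype_card]
    simp only [Function.comp_apply] at h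
    change 2 * (∑ k, f (π k) (π (k + 1))) + _ ≤ _ at h
    simp only [show d + 2 - 1 = d + 1 by omega]
    linarith
  have hsum := Finset.sum_le_card_nsmul Finset.univ _ _ fun π _ => hjacket π
  rw [← Finset.mul_sum, Finset.card_univ, Fintype.card_perm, Fintype.card_fin, smul_eq_mul] at hsum
  refine Nat.le_of_mul_le_mul_right ?_ (Nat.factorial_pos (D + 1))
  calc _ = D * (2 * ∑ π : Equiv.Perm (Fin (D + 1)), ∑ k, f (π k) (π (k + 1))) := by
        linarith
    _ ≤ D * ((D + 1).factorial * (4 + (D - 1) * Nat.card V)) := Nat.mul_le_mul_left D hsum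
    _ = _ := by ring
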